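/- arXiv:0903.4933 — 4 statements merged into one kernel-verified Lean document; each statement's English description precedes it below -/
import Mathlib

section
/- Let d, k, β, l, T be natural numbers with d ≥ 2 and T + β ≤ l. Suppose that one of the following three systems holds: (i) T + 2β + 2 = l + 3k, T + dβ ≤ 2kd, and 2kd ≤ T + dβ + β; or (ii) T + 2β + 2 = l + 3k + 1, T + dβ ≤ 2kd + 1, and 2kd + 1 ≤ T + dβ + β; or (iii) T + 2β = l + 3k and either (T + dβ ≤ 2kd + d and 2kd + d ≤ T + dβ + β) or (T + dβ ≤ 2kd + d + 1 and 2kd + d + 1 ≤ T + dβ + β). Then l ∈ {2, 3, 4, d, d+1}. -/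
theorem bi_koszul_multiplications (d k β l T : ℕ) (hd : 2 ≤ d) (hβT : T + β ≤ l)
    (h : (T + 2 * β + 2 = l + 3 * k ∧ T + d * β ≤ 2 * k * d ∧
            2 * k * d ≤ T + d * β + β) ∨
         (T + 2 * β + 2 = l + 3 * k + 1 ∧ T + d * β ≤ 2 * k * d + 1 ∧
            2 * k * d + 1 ≤ T + d * β + β) ∨
         (T + 2 * β = l + 3 * k ∧
           ((T + d * β ≤ 2 * k * d + d ∧ 2 * k * d + d ≤ T + d * β + β) ∨
             (T + d * β ≤ 2 * k * d + d + 1 ∧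
               2 * k * d + d + 1 ≤ T + d * β + β)))) :
    l = 2 ∨ l = 3 ∨ l = 4 ∨ l = d ∨ l = d + 1 := by
  rcases h with ⟨h1, h2, h3⟩ | ⟨h1, h2, h3⟩ | ⟨h1, h2⟩
  · have hb : β ≤ 2 * k := by
      by_contra hc
      have : d * (2 * k + 1) ≤ d * β := Nat.mul_le_mul_left d (by omega)
      nlinarith
    have hk : k ≤ 2 := by omega
    have hb4 : β ≤ 4 := by omega
    interval_cases k <;> interval_cases β <;> omega
  · have hb : β ≤ 2 * k := by
      by_contra hc
      have : d * (2 * k + 1) ≤ d * β := Nat.mul_le_mul_left d (by omega)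
      nlinarith
    have hk : k ≤ 1 := by omega
    have hb4 : β ≤ 2 := by omega
    interval_cases k <;> interval_cases β <;> omega
  · have h4 : T + d * β ≤ 2 * k * d + d + 1 := by omega
    have hb : β ≤ 2 * k + 1 := by
      by_contra hc
      have : d * (2 * k + 2) ≤ d * β := Nat.mul_le_mul_left d (by omega)
      nlinarith
    have hk : k ≤ 1 := by omega
    have hb4 : β ≤ 3 := by omega
    interval_cases k <;> interval_cases β <;> omega
end

section
/- Let d, k, β, l, T be natural numbers with d = 2 or d = 3, and suppose T + β ≤ l and one of the following three systems holds: (i) T + 2β + 2 = l + 3k, T + dβ ≤ 2kd, and 2kd ≤ T + dβ + β; or (ii) T + 2β + 2 = l + 3k + 1, T + dβ ≤ 2kd + 1, and 2kd + 1 ≤ T + dβ + β; or (iii) T + 2β = l + 3k and either (T + dβ ≤ 2kd + d and 2kd + d ≤ T + dβ + β) or (T + dβ ≤ 2kd + d + 1 and 2kd + d + 1 ≤ T + dβ + β). Then l ∈ {2, 3, 4}. -/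
theorem bi_koszul_multiplications_d2_d3 (d k β l T : ℕ) (hd : d = 2 ∨ d = 3)
    (hβT : T + β ≤ l)
    (h : (T + 2 * β + 2 = l + 3 * k ∧ T + d * β ≤ 2 * k * d ∧
            2 * k * d ≤ T + d * β + β) ∨
         (T + 2 * β + 2 = l + 3 * k + 1 ∧ T + d * β ≤ 2 * k * d + 1 ∧
            2 * k * d + 1 ≤ T + d * β + β) ∨
         (T + 2 * β = l + 3 * k ∧
           ((T + d * β ≤ 2 * k * d + d ∧ 2 * k * d + d ≤ T + d * β + β) ∨
             (T + d * β ≤ 2 * k * d + d + 1 ∧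
               2 * k * d + d + 1 ≤ T + d * β + β)))) :
    l = 2 ∨ l = 3 ∨ l = 4 := by
  rcases hd with rfl | rfl <;> omega
end

section
/- Let d, k, β, T be natural numbers with d ≥ 5, set l = d, and suppose T + β ≤ l and one of the following three systems holds: (i) T + 2β + 2 = l + 3k, T + dβ ≤ 2kd, and 2kd ≤ T + dβ + β; or (ii) T + 2β + 2 = l + 3k + 1, T + dβ ≤ 2kd + 1, and 2kd + 1 ≤ T + dβ + β; or (iii) T + 2β = l + 3k and either (T + dβ ≤ 2kd + d and 2kd + d ≤ T + dβ + β) or (T + dβ ≤ 2kd + d + 1 and 2kd + d + 1 ≤ T + dβ + β). Then (k, β, T) is either (1, 1, d−1) or (0, 0, d). -/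
/-- The internal-degree bounds leave only two possibilities for `m`. -/
theorem md_aux (d β T m e : ℕ) (hd : 5 ≤ d) (hT : T + β ≤ d) (he : e ≤ 1)
    (h1 : T + d * β ≤ m * d + e) (h2 : m * d + e ≤ T + d * β + β) :
    (m = β ∧ T ≤ e) ∨ (m = β + 1 ∧ e = 0 ∧ T + β = d) := by
  rcases Nat.lt_trichotomy m β with h | h | h
  · obtain ⟨j, rfl⟩ := Nat.exists_eq_add_of_lt h
    exfalso
    nlinarith [Nat.zero_le (d * j)]
  · subst h
    left
    exact ⟨rfl, by nlinarith⟩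
  · obtain ⟨j, rfl⟩ := Nat.exists_eq_add_of_lt h
    right
    rcases j with _ | j
    · have h3 : d + e ≤ T + β := by nlinarith
      refine ⟨by omega, by omega, by omega⟩
    · exfalso
      nlinarith [Nat.zero_le (d * j)]

theorem bi_koszul_md_components (d k β T : ℕ) (hd : 5 ≤ d) (l : ℕ) (hl : l = d)
    (hβT : T + β ≤ l)
    (h : (T + 2 * β + 2 = l + 3 * k ∧ T + d * β ≤ 2 * k * d ∧
            2 * k * d ≤ T + d * β + β) ∨
         (T + 2 * β + 2 = l + 3 * k + 1 ∧ T + d * β ≤ 2 * k * d + 1 ∧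
            2 * k * d + 1 ≤ T + d * β + β) ∨
         (T + 2 * β = l + 3 * k ∧
           ((T + d * β ≤ 2 * k * d + d ∧ 2 * k * d + d ≤ T + d * β + β) ∨
             (T + d * β ≤ 2 * k * d + d + 1 ∧
               2 * k * d + d + 1 ≤ T + d * β + β)))) :
    (k, β, T) = (1, 1, d - 1) ∨ (k, β, T) = (0, 0, d) := by
  subst hl
  simp only [Prod.mk.injEq]
  rcases h with ⟨h0, h1, h2⟩ | ⟨h0, h1, h2⟩ | ⟨h0, ⟨h1, h2⟩ | ⟨h1, h2⟩⟩
  · have := md_aux l β T (2 * k) 0 hd hβT (by omega) h1 h2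
    omega
  · have := md_aux l β T (2 * k) 1 hd hβT (by omega) h1 h2
    omega
  · have := md_aux l β T (2 * k + 1) 0 hd hβT (by omega) (by linarith) (by linarith)
    omega
  · have := md_aux l β T (2 * k + 1) 1 hd hβT (by omega) (by linarith) (by linarith)
    omega
end

section
/- Let d, k, β, T be natural numbers with d ≥ 5, set l = d + 1, and suppose T + β ≤ l and one of the following three systems holds: (i) T + 2β + 2 = l + 3k, T + dβ ≤ 2kd, and 2kd ≤ T + dβ + β; or (ii) T + 2β + 2 = l + 3k + 1, T + dβ ≤ 2kd + 1, and 2kd + 1 ≤ T + dβ + β; or (iii) T + 2β = l + 3k and either (T + dβ ≤ 2kd + d and 2kd + d ≤ T + dβ + β) or (T + dβ ≤ 2kd + d + 1 and 2kd + d + 1 ≤ T + dβ + β). Then (k, β, T) is either (1, 1, d) or (0, 0, d+1). -/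
/-- If `T + dβ ≤ md + e` and `md + e ≤ T + dβ + β` with `T + β ≤ d + 1`, `e ≤ 1`,
then `m = β` or `m = β + 1`. -/
theorem bi_koszul_aux (d m β T e : ℕ) (hd : 5 ≤ d) (he : e ≤ 1) (hb : T + β ≤ d + 1)
    (h1 : T + d * β ≤ m * d + e) (h2 : m * d + e ≤ T + d * β + β) :
    (m = β ∧ T ≤ e) ∨ (m = β + 1 ∧ T ≤ d + e ∧ d + e ≤ T + β) := by
  rcases lt_or_ge m β with h | h
  · obtain ⟨c, rfl⟩ := Nat.exists_eq_add_of_lt h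
    exfalso
    nlinarith [Nat.zero_le (d * c)]
  · obtain ⟨c, rfl⟩ := Nat.exists_eq_add_of_le h
    have h1' : T ≤ c * d + e := by nlinarith
    have h2' : c * d + e ≤ T + β := by nlinarith
    have hc : c < 2 := by
      by_contra hc
      have : 2 * d ≤ c * d := Nat.mul_le_mul_right d (by omega)
      omega
    interval_cases c
    · left; omega
    · right; omega

theorem bi_koszul_md1_components (d k β T : ℕ) (hd : 5 ≤ d) (l : ℕ) (hl : l = d + 1)
    (hβT : T + β ≤ l)
    (h : (T + 2 * β + 2 = l + 3 * k ∧ T + d * β ≤ 2 * k * d ∧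
            2 * k * d ≤ T + d * β + β) ∨
         (T + 2 * β + 2 = l + 3 * k + 1 ∧ T + d * β ≤ 2 * k * d + 1 ∧
            2 * k * d + 1 ≤ T + d * β + β) ∨
         (T + 2 * β = l + 3 * k ∧
           ((T + d * β ≤ 2 * k * d + d ∧ 2 * k * d + d ≤ T + d * β + β) ∨
             (T + d * β ≤ 2 * k * d + d + 1 ∧
               2 * k * d + d + 1 ≤ T + d * β + β)))) :
    (k, β, T) = (1, 1, d) ∨ (k, β, T) = (0, 0, d + 1) := by
  subst hl
  simp only [Prod.mk.injEq]
  rcases h with ⟨h0, h1, h2⟩ | ⟨h0, h1, h2⟩ | ⟨h0, ⟨h1, h2⟩ | ⟨h1, h2⟩⟩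
  · have := bi_koszul_aux d (2 * k) β T 0 hd (by omega) hβT (by linarith) (by linarith)
    omega
  · have := bi_koszul_aux d (2 * k) β T 1 hd (by omega) hβT (by linarith) (by linarith)
    omega
  · have := bi_koszul_aux d (2 * k + 1) β T 0 hd (by omega) hβT (by linarith) (by linarith)
    omega
  · have := bi_koszul_aux d (2 * k + 1) β T 1 hd (by omega) hβT (by linarith) (by linarith)
    omega
end
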